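/- arXiv:2205.12833 — 2 statements merged into one kernel-verified Lean document; each statement's English description precedes it below -/
import Mathlib

section
/- For every real r with 0 ≤ r ≤ 1 and every natural number n ≥ 1, the real n×n matrix M with entries M_{ij} = r^{|i-j|} (indices 0 ≤ i, j ≤ n-1) is positive semidefinite. -/
/-- The weighted sum behind the Cholesky factorization of the matrix `r ^ |i - j|`. -/
theorem sum_weight_mul_pow_mul_pow {R : Type*} [CommRing R] (r : R) (d i : ℕ) :
    ∑ k ∈ Finset.range (i + 1),
      (if k = 0 then 1 else 1 - r ^ 2) * (r ^ (i - k) * r ^ (i + d - k)) = r ^ d := by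
  induction i with
  | zero => simp
  | succ i ih =>
    have h : ∀ k ∈ Finset.range (i + 1),
        (if k = 0 then 1 else 1 - r ^ 2) * (r ^ (i + 1 - k) * r ^ (i + 1 + d - k)) =
          r ^ 2 * ((if k = 0 then 1 else 1 - r ^ 2) * (r ^ (i - k) * r ^ (i + d - k))) := by
      intro k hk
      have hk : k < i + 1 := Finset.mem_range.mp hk
      rw [show i + 1 - k = i - k + 1 by lia, show i + 1 + d - k = i + d - k + 1 by lia]
      ring
    rw [Finset.sum_range_succ, Finset.sum_congr rfl h, ← Finset.mul_sum, ih,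
      if_neg i.succ_ne_zero, Nat.sub_self, Nat.add_sub_cancel_left]
    ring

/-- The Cholesky decomposition of the entries `r ^ |i - j|`. -/
theorem sum_weight_mul_ite_pow {R : Type*} [CommRing R] (r : R) {n i j : ℕ}
    (hi : i < n) (hj : j < n) :
    ∑ k ∈ Finset.range n, (if k = 0 then 1 else 1 - r ^ 2) *
      ((if k ≤ i then r ^ (i - k) else 0) * (if k ≤ j then r ^ (j - k) else 0)) =
      r ^ ((i : ℤ) - (j : ℤ)).natAbs := by
  wlog hij : i ≤ j generalizing i j
  · rw [← Int.natAbs_neg, neg_sub, ← this hj hi (by lia)]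
    exact Finset.sum_congr rfl fun k _ => by ring
  obtain ⟨d, rfl⟩ := Nat.exists_eq_add_of_le hij
  rw [show ((i : ℤ) - ((i + d : ℕ) : ℤ)).natAbs = d by lia, ← sum_weight_mul_pow_mul_pow r d i]
  symm
  refine Finset.sum_subset_zero_on_sdiff (Finset.range_mono hi) ?_ ?_
  · intro k hk
    have hk : ¬ k ≤ i := by simp at hk; lia
    simp [hk]
  · intro k hk
    have hk : k ≤ i := Nat.lt_succ_iff.mp (Finset.mem_range.mp hk)
    simp [hk, hk.trans hij]

theorem stmt_11 (r : ℝ) (hr0 : 0 ≤ r) (hr1 : r ≤ 1) (n : ℕ) (hn : 1 ≤ n) :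
    (Matrix.of fun i j : Fin n => r ^ ((i : ℤ) - (j : ℤ)).natAbs).PosSemidef := by
  let v (k : ℕ) (i : Fin n) : ℝ := if k ≤ (i : ℕ) then r ^ ((i : ℕ) - k) else 0
  have h : (Matrix.of fun i j : Fin n => r ^ ((i : ℤ) - (j : ℤ)).natAbs) =
      ∑ k ∈ Finset.range n,
        (if k = 0 then 1 else 1 - r ^ 2 : ℝ) • Matrix.vecMulVec (v k) (star (v k)) := by
    ext i j
    rw [Matrix.sum_apply, Matrix.of_apply, ← sum_weight_mul_ite_pow r i.isLt j.isLt]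
    rfl
  rw [h]
  refine Matrix.posSemidef_sum _ fun k _ => (Matrix.posSemidef_vecMulVec_self_star _).smul ?_
  split_ifs
  · exact zero_le_one
  · exact sub_nonneg.mpr (pow_le_one₀ hr0 hr1)
end

section
/- Fix a real r with 0 < r < 1 and an integer d ≥ 0, and let A be the real (d+1)×(d+1) matrix with entries A_{ij} = (1 - r²) r^{d} r^{|i+j-d|} for 0 ≤ i, j ≤ d, where |i+j-d| is the absolute value of the integer i+j-d. Then there exists an orthogonal (d+1)×(d+1) matrix U such that A·U is symmetric positive semidefinite and has trace equal to (d+1)(1 - r²) r^{d}. (Consequently the trace norm of A equals (d+1)(1 - r²) r^{d}.) -/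
open Matrix

/-- A telescoping identity: the geometric weights of a stationary AR(1) sequence sum to one. -/
lemma sum_range_weight_mul_pow_sq (r : ℝ) (i : ℕ) :
    ∑ k ∈ Finset.range (i + 1), (if k = 0 then 1 else 1 - r ^ 2) * (r ^ (i - k)) ^ 2 = 1 := by
  induction i with
  | zero => simp
  | succ i ih =>
    rw [Finset.sum_range_succ]
    have h : ∀ k ∈ Finset.range (i + 1),
        (if k = 0 then 1 else 1 - r ^ 2) * (r ^ (i + 1 - k)) ^ 2 =
          r ^ 2 * ((if k = 0 then 1 else 1 - r ^ 2) * (r ^ (i - k)) ^ 2) := by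
      intro k hk
      rw [Nat.sub_add_comm (Finset.mem_range_succ_iff.mp hk), pow_succ]
      ring
    rw [Finset.sum_congr rfl h, ← Finset.mul_sum, ih]
    simp

lemma sum_range_weight_mul_pow_mul_pow (r : ℝ) {n i j : ℕ} (hij : i ≤ j) (hi : i < n) :
    ∑ k ∈ Finset.range n, (if k = 0 then 1 else 1 - r ^ 2) *
      ((if k ≤ i then r ^ (i - k) else 0) * (if k ≤ j then r ^ (j - k) else 0)) = r ^ (j - i) := by
  rw [← Finset.sum_subset (Finset.range_mono (Nat.succ_le_of_lt hi))]
  · refine Eq.trans ?_ ((congrArg (r ^ (j - i) * ·) (sum_range_weight_mul_pow_sq r i)).trans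
      (mul_one _))
    simp only [Finset.mul_sum]
    refine Finset.sum_congr rfl fun k hk => ?_
    have hki := Finset.mem_range_succ_iff.mp hk
    rw [if_pos hki, if_pos (hki.trans hij), show j - k = (i - k) + (j - i) by omega, pow_add]
    ring
  · intro k _ hk
    have hki : ¬ k ≤ i := fun h => hk (Finset.mem_range_succ_iff.mpr h)
    simp [hki]

/-- The symmetric Toeplitz matrix `r ^ |i - j|` is positive semidefinite when `|r| ≤ 1`. -/
lemma posSemidef_pow_natAbs_sub {r : ℝ} (hr : r ^ 2 ≤ 1) (n : ℕ) :
    (Matrix.of fun i j : Fin n => r ^ ((i : ℤ) - (j : ℤ)).natAbs).PosSemidef := by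
  have h : (Matrix.of fun i j : Fin n => r ^ ((i : ℤ) - (j : ℤ)).natAbs) =
      ∑ k ∈ Finset.range n, (if k = 0 then 1 else 1 - r ^ 2) •
        vecMulVec (fun i : Fin n => if k ≤ (i : ℕ) then r ^ ((i : ℕ) - k) else 0)
          (star fun i : Fin n => if k ≤ (i : ℕ) then r ^ ((i : ℕ) - k) else 0) := by
    ext i j
    simp only [Matrix.sum_apply, Matrix.smul_apply, vecMulVec_apply, star_trivial, smul_eq_mul,
      of_apply]
    rcases le_total (i : ℕ) j with hij | hij
    · rw [sum_range_weight_mul_pow_mul_pow r hij i.2]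
      congr 1
      omega
    · simp_rw [mul_comm (if _ ≤ (i : ℕ) then _ else _)]
      rw [sum_range_weight_mul_pow_mul_pow r hij j.2]
      congr 1
      omega
  rw [h]
  refine posSemidef_sum _ fun k _ => (posSemidef_vecMulVec_self_star _).smul ?_
  split_ifs <;> linarith

theorem stmt_13 (r : ℝ) (hr0 : 0 < r) (hr1 : r < 1) (d : ℕ)
    (A : Matrix (Fin (d + 1)) (Fin (d + 1)) ℝ)
    (hA : ∀ i j : Fin (d + 1),
      A i j = (1 - r ^ 2) * r ^ d * r ^ ((i : ℤ) + (j : ℤ) - (d : ℤ)).natAbs) :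
    ∃ U : Matrix (Fin (d + 1)) (Fin (d + 1)) ℝ,
      U * U.transpose = 1 ∧ (A * U).PosSemidef ∧
        (A * U).trace = (d + 1) * (1 - r ^ 2) * r ^ d := by
  have hr : r ^ 2 ≤ 1 := pow_le_one₀ hr0.le hr1.le
  have hU : A * (1 : Matrix _ _ ℝ).submatrix id Fin.revPerm =
      ((1 - r ^ 2) * r ^ d) •
        Matrix.of fun i j : Fin (d + 1) => r ^ ((i : ℤ) - (j : ℤ)).natAbs := by
    ext i j
    have hj : A i (Fin.rev j) = (1 - r ^ 2) * r ^ d * r ^ ((i : ℤ) - (j : ℤ)).natAbs := by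
      rw [hA, Fin.val_rev]
      congr 3
      omega
    simpa [Matrix.mul_apply, Matrix.one_apply] using hj
  refine ⟨(1 : Matrix _ _ ℝ).submatrix id Fin.revPerm, ?_, ?_, ?_⟩
  · rw [transpose_submatrix, transpose_one, submatrix_mul_equiv, mul_one, submatrix_id_id]
  · rw [hU]
    exact (posSemidef_pow_natAbs_sub hr _).smul
      (mul_nonneg (sub_nonneg.mpr hr) (pow_nonneg hr0.le d))
  · rw [hU]
    simp [Matrix.trace, mul_assoc]
end
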